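/- (Lemma 1 of the paper, abstract form with locations.) Let G be a finite tree with vertex set V, let L be a finite nonempty set of locations, and let r ∈ V with neighbor set N(r). Then for every location x ∈ L, the maximum of F(S, ℓ) over all connected subsets S ⊆ V with r ∈ S and all assignments ℓ : S → L with ℓ(r) = x equals a(r, x) + ∑_{k ∈ N(r)} max( D(r,k,x), max_{y ∈ L} ( R_{rk}(x,y) + M(k→r)(y) ) ), where M(k→r)(y) denotes the maximum of F_{B(r,k)}(S', ℓ') over all connected subsets S' of the branch B(r,k) with k ∈ S' and all assignments ℓ' : S' → L with ℓ'(k) = y. -/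

import Mathlib

open scoped Classical

/-- A subset of vertices is connected if the subgraph induced on it is connected. -/
def IsConnSubset {V : Type*} (G : SimpleGraph V) (S : Set V) : Prop :=
  (G.induce S).Connected

/-- The branch `B(r,k)` of a neighbor `k` at `r`: the vertex set of the connected
component containing `k` of the graph obtained from `G` by deleting the vertex `r`. -/
def branch {V : Type*} (G : SimpleGraph V) (r k : V) : Set V :=
  {v : V | ∃ (hk : k ≠ r) (hv : v ≠ r),
    (G.induce {x : V | x ≠ r}).Reachable ⟨k, hk⟩ ⟨v, hv⟩}

/-- The location-dependent score `F_W(S, ℓ)` of a subset `S` with location assignment `ℓ`,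
computed within the subgraph of `G` induced on `W`: the sum of the appearance scores
`a(v, ℓ(v))` over `v ∈ S`, plus the sum over edges of `G` with both endpoints in `S` of
the pairwise relational scores `R_{ij}(ℓ(i), ℓ(j))` (each edge counted once: given the
symmetry `R_{ij}(x,y) = R_{ji}(y,x)` this equals half the sum over ordered pairs), plus
the sum of the decoupling scores `D(i,j,ℓ(i))` over ordered pairs `(i,j)` of adjacent
vertices of `G` lying in `W` with `i ∈ S` and `j ∉ S`. Only the values of `ℓ` on `S`
matter. Taking `W = Set.univ` gives the full score `F(S, ℓ)`. -/
noncomputable def scoreL {V L : Type*} (G : SimpleGraph V) (a : V → L → ℝ)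
    (R : V → V → L → L → ℝ) (D : V → V → L → ℝ) (W S : Set V) (ℓ : V → L) : ℝ :=
  (∑ᶠ v ∈ S, a v (ℓ v))
    + (1 / 2) * (∑ᶠ p ∈ {p : V × V | G.Adj p.1 p.2 ∧ p.1 ∈ S ∧ p.2 ∈ S},
        R p.1 p.2 (ℓ p.1) (ℓ p.2))
    + (∑ᶠ p ∈ {p : V × V | G.Adj p.1 p.2 ∧ p.1 ∈ W ∧ p.2 ∈ W ∧ p.1 ∈ S ∧ p.2 ∉ S},
        D p.1 p.2 (ℓ p.1))

section Branch

variable {V : Type*} {G : SimpleGraph V} {r k : V}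

lemma self_mem_branch (h : G.Adj r k) : k ∈ branch G r k :=
  ⟨h.ne', h.ne', SimpleGraph.Reachable.refl _⟩

lemma ne_of_mem_branch {v : V} (h : v ∈ branch G r k) : v ≠ r := h.2.1

lemma mem_branch_of_adj {v w : V} (hv : v ∈ branch G r k) (h : G.Adj v w) (hw : w ≠ r) :
    w ∈ branch G r k := by
  obtain ⟨hk, hvr, hreach⟩ := hv
  exact ⟨hk, hw, hreach.trans (SimpleGraph.Adj.reachable (SimpleGraph.induce_adj.2 h))⟩

lemma eq_of_adj_of_mem_branch (hG : G.IsAcyclic) {v : V} (hk : G.Adj r k) (hv : G.Adj r v)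
    (h : v ∈ branch G r k) : v = k := by
  obtain ⟨hkr, hvr, hreach⟩ := h
  obtain ⟨p, hp⟩ := hreach.exists_isPath
  let f := (SimpleGraph.Embedding.induce (G := G) {x : V | x ≠ r})
  have hq : (p.map f.toHom).IsPath :=
    hp.map f.injective
  have hr : r ∉ (p.map f.toHom).support := by
    rw [SimpleGraph.Walk.support_map, List.mem_map]
    rintro ⟨u, -, hu⟩
    exact u.2 hu
  have hc : (SimpleGraph.Walk.cons hk (p.map f.toHom)).IsPath := hq.cons hr
  have hs : (SimpleGraph.Walk.cons hv SimpleGraph.Walk.nil).IsPath := by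
    simp [hv.ne]
  have hlen : (p.map f.toHom).length + 1 = 0 + 1 :=
    congrArg (fun q : G.Path r v => q.1.length)
      ((hG.subsingleton_path r v).elim ⟨_, hc⟩ ⟨_, hs⟩)
  have h0 : p.length = 0 := by
    rw [SimpleGraph.Walk.length_map] at hlen
    exact Nat.succ_injective hlen
  exact (congrArg Subtype.val (SimpleGraph.Walk.eq_of_length_eq_zero h0)).symm

lemma branch_index_unique (hG : G.IsAcyclic) {k' v : V} (hk : G.Adj r k) (hk' : G.Adj r k')
    (h : v ∈ branch G r k) (h' : v ∈ branch G r k') : k = k' := by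
  obtain ⟨hkr, hvr, hreach⟩ := h
  obtain ⟨hkr', hvr', hreach'⟩ := h'
  exact eq_of_adj_of_mem_branch hG hk' hk ⟨hkr', hkr, hreach'.trans hreach.symm⟩

lemma exists_reachable_inter_branch {S : Set V} (hr : r ∈ S) (hS : IsConnSubset G S)
    {v : V} (hv : v ∈ S) (hvr : v ≠ r) :
    ∃ k, G.Adj r k ∧ ∃ (hk : k ∈ S ∩ branch G r k) (hv : v ∈ S ∩ branch G r k),
      (G.induce (S ∩ branch G r k)).Reachable ⟨k, hk⟩ ⟨v, hv⟩ := by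
  have key : ∀ w : S, Relation.ReflTransGen (G.induce S).Adj ⟨r, hr⟩ w → (w : V) ≠ r →
      ∃ k, G.Adj r k ∧ ∃ (hk : k ∈ S ∩ branch G r k) (hv : (w : V) ∈ S ∩ branch G r k),
        (G.induce (S ∩ branch G r k)).Reachable ⟨k, hk⟩ ⟨w, hv⟩ := by
    intro w hw
    induction hw with
    | refl => exact fun h => absurd rfl h
    | @tail u w _ huw ih =>
      intro hwr
      have huw' : G.Adj u w := huw
      by_cases hur : (u : V) = r
      · have hrw : G.Adj r w := hur ▸ huw'
        have hm : (w : V) ∈ S ∩ branch G r w := ⟨w.2, self_mem_branch hrw⟩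
        exact ⟨w, hrw, hm, hm, SimpleGraph.Reachable.refl _⟩
      · obtain ⟨k, hk, hkm, hum, hreach⟩ := ih hur
        exact ⟨k, hk, hkm, ⟨w.2, mem_branch_of_adj hum.2 huw' hwr⟩,
          hreach.trans (SimpleGraph.Adj.reachable (SimpleGraph.induce_adj.2 huw'))⟩
  exact key ⟨v, hv⟩ ((SimpleGraph.reachable_iff_reflTransGen _ _).1 (hS.preconnected _ _)) hvr

lemma isConnSubset_univ (hG : G.Connected) : IsConnSubset G Set.univ :=
  (SimpleGraph.induceUnivIso G).connected_iff.2 hG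

lemma exists_mem_branch (hG : G.Connected) {v : V} (hv : v ≠ r) :
    ∃ k, G.Adj r k ∧ v ∈ branch G r k := by
  obtain ⟨k, hk, -, hm, -⟩ :=
    exists_reachable_inter_branch (Set.mem_univ r) (isConnSubset_univ hG) (Set.mem_univ v) hv
  exact ⟨k, hk, hm.2⟩

lemma mem_of_mem_inter_branch (hG : G.IsAcyclic) {S : Set V} (hr : r ∈ S)
    (hS : IsConnSubset G S) (hk : G.Adj r k) {v : V} (hv : v ∈ S ∩ branch G r k) : k ∈ S := by
  obtain ⟨k', hk', hkm, hm, -⟩ :=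
    exists_reachable_inter_branch hr hS hv.1 (ne_of_mem_branch hv.2)
  obtain rfl := branch_index_unique hG hk hk' hv.2 hm.2
  exact hkm.1

lemma isConnSubset_inter_branch (hG : G.IsAcyclic) {S : Set V} (hr : r ∈ S)
    (hS : IsConnSubset G S) (hk : G.Adj r k) (hkS : k ∈ S) :
    IsConnSubset G (S ∩ branch G r k) := by
  refine (SimpleGraph.connected_iff_exists_forall_reachable _).2
    ⟨⟨k, hkS, self_mem_branch hk⟩, fun ⟨v, hv⟩ => ?_⟩
  obtain ⟨k', hk', hkm, hm, hreach⟩ :=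
    exists_reachable_inter_branch hr hS hv.1 (ne_of_mem_branch hv.2)
  obtain rfl := branch_index_unique hG hk hk' hv.2 hm.2
  exact hreach

lemma isConnSubset_insert_iUnion (T : {k // G.Adj r k} → Set V)
    (hT : ∀ k, (T k).Nonempty → (k : V) ∈ T k ∧ IsConnSubset G (T k)) :
    IsConnSubset G (insert r (⋃ k, T k)) := by
  refine (SimpleGraph.connected_iff_exists_forall_reachable _).2
    ⟨⟨r, Set.mem_insert _ _⟩, fun ⟨v, hv⟩ => ?_⟩
  obtain rfl | hv' := hv
  · exact SimpleGraph.Reachable.refl _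
  obtain ⟨k, hvk⟩ := Set.mem_iUnion.1 hv'
  obtain ⟨hkT, hconn⟩ := hT k ⟨v, hvk⟩
  have hsub : T k ⊆ insert r (⋃ k, T k) :=
    (Set.subset_iUnion T k).trans (Set.subset_insert _ _)
  have hreach := (hconn.preconnected ⟨k, hkT⟩ ⟨v, hvk⟩).map
    (SimpleGraph.induceHomOfLE G hsub).toHom
  refine SimpleGraph.Reachable.trans ?_ hreach
  exact SimpleGraph.Adj.reachable (SimpleGraph.induce_adj.2 k.2)

lemma isConnSubset_singleton (v : V) : IsConnSubset G {v} :=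
  (SimpleGraph.connected_iff_exists_forall_reachable _).2
    ⟨⟨v, rfl⟩, fun ⟨w, hw⟩ => by
      obtain rfl : w = v := hw
      exact SimpleGraph.Reachable.refl _⟩

end Branch

section Score

variable {V L : Type*} (G : SimpleGraph V) (a : V → L → ℝ) (R : V → V → L → L → ℝ)
  (D : V → V → L → ℝ)

/-- The contribution of the ordered pair `(v, u)` to the score of `S` within `W`, when `v ∈ S`;
each edge inside `S` is split evenly between its two orientations. -/
noncomputable def pairScore (W S : Set V) (ℓ : V → L) (v u : V) : ℝ :=
  if G.Adj v u then
    if u ∈ S then (1 / 2) * R v u (ℓ v) (ℓ u)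
    else if v ∈ W ∧ u ∈ W then D v u (ℓ v) else 0
  else 0

/-- The contribution of the vertex `v` to the score of `S` within `W`. -/
noncomputable def vertexScore [Fintype V] (W S : Set V) (ℓ : V → L) (v : V) : ℝ :=
  if v ∈ S then a v (ℓ v) + ∑ u, pairScore G R D W S ℓ v u else 0

variable {G a R D}

lemma scoreL_eq_sum_vertexScore [Fintype V] (W S : Set V) (ℓ : V → L) :
    scoreL G a R D W S ℓ = ∑ v, vertexScore G a R D W S ℓ v := by
  rw [scoreL, finsum_mem_def, finsum_mem_def, finsum_mem_def]
  simp only [finsum_eq_sum_of_fintype, Fintype.sum_prod_type,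
    Finset.mul_sum, ← Finset.sum_add_distrib]
  refine Finset.sum_congr rfl fun v _ => ?_
  by_cases hv : v ∈ S
  · simp only [vertexScore, hv, if_true, Set.indicator_of_mem, add_assoc]
    rw [← Finset.sum_add_distrib]
    congr 1
    refine Finset.sum_congr rfl fun u _ => ?_
    by_cases h : G.Adj v u <;> by_cases hu : u ∈ S <;>
      simp [pairScore, Set.indicator_apply, h, hu, hv]
  · simp [vertexScore, hv]

lemma scoreL_congr [Fintype V] {W S : Set V} {ℓ ℓ' : V → L} (h : ∀ v ∈ S, ℓ v = ℓ' v) :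
    scoreL G a R D W S ℓ = scoreL G a R D W S ℓ' := by
  simp only [scoreL_eq_sum_vertexScore]
  refine Finset.sum_congr rfl fun v _ => ?_
  by_cases hv : v ∈ S
  · simp only [vertexScore, hv, if_true, h v hv]
    congr 1
    refine Finset.sum_congr rfl fun u _ => ?_
    by_cases hu : u ∈ S
    · simp [pairScore, hu, h v hv, h u hu]
    · simp [pairScore, hu, h v hv]
  · simp [vertexScore, hv]

lemma scoreL_empty [Fintype V] (W : Set V) (ℓ : V → L) : scoreL G a R D W ∅ ℓ = 0 := by
  simp [scoreL_eq_sum_vertexScore, vertexScore]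

lemma sum_eq_add_sum_branch [Fintype V] (hG : G.IsTree) (r : V) (f : V → ℝ) :
    ∑ v, f v = f r + ∑ k : {k // G.Adj r k}, ∑ v, if v ∈ branch G r k then f v else 0 := by
  rw [Finset.sum_comm, ← Finset.add_sum_erase _ f (Finset.mem_univ r),
    ← Finset.add_sum_erase _ _ (Finset.mem_univ r)]
  have hr : ∀ k : {k // G.Adj r k}, r ∉ branch G r k := fun k h => ne_of_mem_branch h rfl
  simp only [hr, if_false, Finset.sum_const_zero, zero_add]
  congr 1
  refine Finset.sum_congr rfl fun v hv => ?_
  obtain ⟨k, hk, hvk⟩ := exists_mem_branch hG.connected (Finset.ne_of_mem_erase hv)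
  rw [Finset.sum_eq_single ⟨k, hk⟩, if_pos hvk]
  · intro k' _ hne
    refine if_neg fun h => hne (Subtype.ext ?_)
    exact branch_index_unique hG.isAcyclic k'.2 hk h hvk
  · simp

/-- Passing from the whole tree to a branch only loses the half-edge from `k` to `r`. -/
lemma vertexScore_univ_of_mem_branch [Fintype V] (hG : G.IsAcyclic) {r k v : V}
    (hk : G.Adj r k) {S : Set V} (hr : r ∈ S) (ℓ : V → L) (hv : v ∈ branch G r k) :
    vertexScore G a R D Set.univ S ℓ v =
      vertexScore G a R D (branch G r k) (S ∩ branch G r k) ℓ v +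
        if v = k then (if k ∈ S then (1 / 2) * R k r (ℓ k) (ℓ r) else 0) else 0 := by
  by_cases hvS : v ∈ S
  swap
  · have : v = k → k ∉ S := fun h => h ▸ hvS
    by_cases h : v = k <;> simp_all [vertexScore]
  have hpair : ∀ u, pairScore G R D Set.univ S ℓ v u =
      pairScore G R D (branch G r k) (S ∩ branch G r k) ℓ v u +
        if u = r then (if v = k then (1 / 2) * R k r (ℓ k) (ℓ r) else 0) else 0 := by
    intro u
    have hrb : r ∉ branch G r k := fun h => ne_of_mem_branch h rfl
    by_cases hur : u = r
    · subst hur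
      by_cases hvk : v = k
      · subst hvk
        simp [pairScore, hk.symm, hr, hrb]
      · have : ¬ G.Adj v u := fun h => hvk (eq_of_adj_of_mem_branch hG hk h.symm hv)
        simp [pairScore, this, hvk]
    · by_cases huv : G.Adj v u
      · have hu := mem_branch_of_adj hv huv hur
        simp [pairScore, huv, hur, hu, hv]
      · simp [pairScore, huv, hur]
  simp only [vertexScore, hvS, hv, Set.mem_inter_iff, and_self, if_true, hpair,
    Finset.sum_add_distrib, Finset.sum_ite_eq', Finset.mem_univ, add_assoc]
  by_cases hvk : v = k
  · subst hvk
    simp [hvS]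
  · simp [hvk]

lemma sum_vertexScore_branch [Fintype V] (hG : G.IsAcyclic) {r k : V}
    (hk : G.Adj r k) {S : Set V} (hr : r ∈ S) (ℓ : V → L) :
    (∑ v, if v ∈ branch G r k then vertexScore G a R D Set.univ S ℓ v else 0) =
      scoreL G a R D (branch G r k) (S ∩ branch G r k) ℓ +
        if k ∈ S then (1 / 2) * R k r (ℓ k) (ℓ r) else 0 := by
  have hterm : ∀ v, (if v ∈ branch G r k then vertexScore G a R D Set.univ S ℓ v else 0) =
      vertexScore G a R D (branch G r k) (S ∩ branch G r k) ℓ v +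
        if v = k then (if k ∈ S then (1 / 2) * R k r (ℓ k) (ℓ r) else 0) else 0 := by
    intro v
    by_cases hv : v ∈ branch G r k
    · rw [if_pos hv, vertexScore_univ_of_mem_branch hG hk hr ℓ hv]
    · have : v ≠ k := by
        rintro rfl
        exact hv (self_mem_branch hk)
      simp [hv, this, vertexScore]
  simp only [hterm, Finset.sum_add_distrib, scoreL_eq_sum_vertexScore, Finset.sum_ite_eq',
    Finset.mem_univ, if_true]

lemma vertexScore_univ_root [Fintype V] {r : V} {S : Set V} (hr : r ∈ S) (ℓ : V → L) :
    vertexScore G a R D Set.univ S ℓ r = a r (ℓ r) + ∑ k : {k // G.Adj r k},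
      if (k : V) ∈ S then (1 / 2) * R r k (ℓ r) (ℓ k) else D r k (ℓ r) := by
  rw [vertexScore, if_pos hr]
  congr 1
  simp only [pairScore, Set.mem_univ, and_self, if_true]
  rw [← Finset.sum_filter]
  exact Finset.sum_subtype _ (by simp) _

lemma scoreL_univ_eq_sum_branch [Fintype V] (hG : G.IsTree)
    (hR : ∀ i j x y, R i j x y = R j i y x) {r : V} {S : Set V} (hr : r ∈ S)
    (hS : IsConnSubset G S) (ℓ : V → L) :
    scoreL G a R D Set.univ S ℓ = a r (ℓ r) + ∑ k : {k // G.Adj r k},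
      if (k : V) ∈ S then
        R r k (ℓ r) (ℓ k) + scoreL G a R D (branch G r k) (S ∩ branch G r k) ℓ
      else D r k (ℓ r) := by
  rw [scoreL_eq_sum_vertexScore, sum_eq_add_sum_branch hG r, vertexScore_univ_root hr, add_assoc,
    ← Finset.sum_add_distrib]
  congr 1
  refine Finset.sum_congr rfl fun k _ => ?_
  rw [sum_vertexScore_branch hG.isAcyclic k.2 hr]
  by_cases hk : (k : V) ∈ S
  · simp only [hk, if_true]
    rw [hR k r]
    ring
  · have : S ∩ branch G r k = ∅ := Set.eq_empty_of_forall_notMem fun v hv =>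
      hk (mem_of_mem_inter_branch hG.isAcyclic hr hS k.2 hv)
    simp [hk, this, scoreL_empty]

variable (G a R D)

/-- The scores, within the branch `B(r,k)`, of connected subsets containing `k` with `k` placed
at `y`; the supremum of this set is the message `M(k→r)(y)`. -/
def branchScores (r k : V) (y : L) : Set ℝ :=
  {u : ℝ | ∃ (S' : Set V) (ℓ' : V → L), S' ⊆ branch G r k ∧ k ∈ S' ∧ IsConnSubset G S' ∧
    ℓ' k = y ∧ u = scoreL G a R D (branch G r k) S' ℓ'}

/-- The values maximised over the location `y` of `k` when `k` is included. -/
def messageScores (r k : V) (x : L) : Set ℝ :=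
  {t : ℝ | ∃ y : L, t = R r k x y + sSup (branchScores G a R D r k y)}

variable {G a R D}

lemma isGreatest_sSup_branchScores [Finite V] [Finite L] {r k : V} (hk : G.Adj r k) (y : L) :
    IsGreatest (branchScores G a R D r k y) (sSup (branchScores G a R D r k y)) := by
  have hfin : (branchScores G a R D r k y).Finite := by
    refine (Set.finite_range
      fun p : Set V × (V → L) => scoreL G a R D (branch G r k) p.1 p.2).subset ?_
    rintro _ ⟨S', ℓ', -, -, -, -, rfl⟩
    exact ⟨(S', ℓ'), rfl⟩
  have hne : (branchScores G a R D r k y).Nonempty :=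
    ⟨_, {k}, fun _ => y, Set.singleton_subset_iff.2 (self_mem_branch hk), rfl,
      isConnSubset_singleton k, rfl, rfl⟩
  exact ⟨hne.csSup_mem hfin, fun _ h => le_csSup hfin.bddAbove h⟩

lemma isGreatest_sSup_messageScores [Finite L] [Nonempty L] (r k : V) (x : L) :
    IsGreatest (messageScores G a R D r k x) (sSup (messageScores G a R D r k x)) := by
  have hfin : (messageScores G a R D r k x).Finite := by
    refine (Set.finite_range
      fun y => R r k x y + sSup (branchScores G a R D r k y)).subset ?_
    rintro _ ⟨y, rfl⟩
    exact ⟨y, rfl⟩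
  have hne : (messageScores G a R D r k x).Nonempty := ⟨_, Classical.arbitrary L, rfl⟩
  exact ⟨hne.csSup_mem hfin, fun _ h => le_csSup hfin.bddAbove h⟩

lemma exists_subset_branch_attaining_max [Finite V] [Finite L] [Nonempty L] {r k : V}
    (hk : G.Adj r k) (x : L) :
    ∃ (T : Set V) (ℓ : V → L), T ⊆ branch G r k ∧
      (T.Nonempty → k ∈ T ∧ IsConnSubset G T) ∧
      max (D r k x) (sSup (messageScores G a R D r k x)) =
        if k ∈ T then R r k x (ℓ k) + scoreL G a R D (branch G r k) T ℓ else D r k x := by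
  rcases le_total (sSup (messageScores G a R D r k x)) (D r k x) with h | h
  · exact ⟨∅, fun _ => x, Set.empty_subset _, fun h => absurd h Set.not_nonempty_empty,
      by simp [h]⟩
  · obtain ⟨y, hy⟩ := (isGreatest_sSup_messageScores (G := G) (a := a) (R := R) (D := D) r k x).1
    obtain ⟨T, ℓ, hT, hkT, hconn, hℓ, hmax⟩ :=
      (isGreatest_sSup_branchScores (a := a) (R := R) (D := D) hk y).1
    exact ⟨T, ℓ, hT, fun _ => ⟨hkT, hconn⟩, by rw [max_eq_right h, hy, hmax, if_pos hkT, hℓ]⟩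

end Score

/-- Lemma 1 of the paper, abstract form with locations: for a finite tree
`G`, a finite nonempty set of locations `L`, a vertex `r` and every location `x`, the
maximum of `F(S, ℓ)` over connected subsets `S ∋ r` and assignments `ℓ` with `ℓ(r) = x`
equals `a(r,x) + ∑_{k ∈ N(r)} max( D(r,k,x), max_{y ∈ L} ( R_{rk}(x,y) + M(k→r)(y) ) )`,
where `M(k→r)(y)` is the maximum of `F_{B(r,k)}(S', ℓ')` over connected subsets `S'` of
the branch `B(r,k)` containing `k` and assignments `ℓ'` with `ℓ'(k) = y`. -/
theorem stmt3 {V L : Type*} [Fintype V] [Fintype L] [Nonempty L]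
    (G : SimpleGraph V) (hG : G.IsTree)
    (a : V → L → ℝ) (R : V → V → L → L → ℝ) (D : V → V → L → ℝ)
    (hR : ∀ i j x y, R i j x y = R j i y x)
    (r : V) (x : L) :
    IsGreatest
      {t : ℝ | ∃ (S : Set V) (ℓ : V → L), r ∈ S ∧ IsConnSubset G S ∧ ℓ r = x ∧
        t = scoreL G a R D Set.univ S ℓ}
      (a r x + ∑ k : {k // G.Adj r k},
        max (D r (k : V) x)
          (sSup {t : ℝ | ∃ y : L,
            t = R r (k : V) x y +
              sSup {u : ℝ | ∃ (S' : Set V) (ℓ' : V → L),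
                S' ⊆ branch G r (k : V) ∧ (k : V) ∈ S' ∧ IsConnSubset G S' ∧
                ℓ' (k : V) = y ∧
                u = scoreL G a R D (branch G r (k : V)) S' ℓ'}})) := by
  change IsGreatest _ (a r x + ∑ k : {k // G.Adj r k},
    max (D r k x) (sSup (messageScores G a R D r k x)))
  constructor
  · choose T ℓ hTB hT hmax using fun k : {k // G.Adj r k} =>
      exists_subset_branch_attaining_max (a := a) (R := R) (D := D) k.2 x
    have hlabel : ∃ ℓ₀ : V → L, ℓ₀ r = x ∧
        ∀ k : {k // G.Adj r k}, ∀ v ∈ branch G r k, ℓ₀ v = ℓ k v := by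
      refine ⟨fun v => if h : ∃ k : {k // G.Adj r k}, v ∈ branch G r k then ℓ h.choose v else x,
        dif_neg fun ⟨k, hk⟩ => ne_of_mem_branch hk rfl, fun k v hv => ?_⟩
      have h : ∃ k : {k // G.Adj r k}, v ∈ branch G r k := ⟨k, hv⟩
      have hk : h.choose = k := Subtype.ext
        (branch_index_unique hG.isAcyclic h.choose.2 k.2 h.choose_spec hv)
      simp only [dif_pos h, hk]
    obtain ⟨ℓ₀, hℓr, hℓ⟩ := hlabel
    have hconn := isConnSubset_insert_iUnion T hT
    have hinter : ∀ k : {k // G.Adj r k}, insert r (⋃ k, T k) ∩ branch G r k = T k := by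
      intro k
      refine Set.Subset.antisymm ?_ fun v hv =>
        ⟨Or.inr (Set.mem_iUnion.2 ⟨k, hv⟩), hTB k hv⟩
      rintro v ⟨rfl | hv, hvk⟩
      · exact absurd rfl (ne_of_mem_branch hvk)
      · obtain ⟨k', hk'⟩ := Set.mem_iUnion.1 hv
        obtain rfl : k' = k := Subtype.ext
          (branch_index_unique hG.isAcyclic k'.2 k.2 (hTB k' hk') hvk)
        exact hk'
    refine ⟨insert r (⋃ k, T k), ℓ₀, Set.mem_insert _ _, hconn, hℓr, ?_⟩
    rw [scoreL_univ_eq_sum_branch hG hR (Set.mem_insert _ _) hconn, hℓr]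
    congr 1
    refine Finset.sum_congr rfl fun k _ => ?_
    have hmem : (k : V) ∈ insert r (⋃ k, T k) ↔ (k : V) ∈ T k := by
      refine ⟨fun h => ?_, fun h => Or.inr (Set.mem_iUnion.2 ⟨k, h⟩)⟩
      rw [← hinter k]
      exact ⟨h, self_mem_branch k.2⟩
    rw [hmax k, hinter, hℓ k k (self_mem_branch k.2),
      scoreL_congr fun v hv => hℓ k v (hTB k hv)]
    simp only [hmem]
  · rintro _ ⟨S, ℓ, hr, hS, rfl, rfl⟩
    rw [scoreL_univ_eq_sum_branch hG hR hr hS]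
    gcongr with k
    split_ifs with hk
    · refine le_max_of_le_right (le_trans ?_
        ((isGreatest_sSup_messageScores r k (ℓ r)).2 ⟨ℓ k, rfl⟩))
      gcongr
      exact (isGreatest_sSup_branchScores k.2 (ℓ k)).2 ⟨S ∩ branch G r k, ℓ,
        Set.inter_subset_right, ⟨hk, self_mem_branch k.2⟩,
        isConnSubset_inter_branch hG.isAcyclic hr hS k.2 hk, rfl, rfl⟩
    · exact le_max_left _ _
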